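/- Let G be a finite simple graph on n vertices without isolated vertices. Then pd(G) ≤ n − τ(G). -/

import Mathlib

open CategoryTheory
open scoped ENNReal

noncomputable def projDim (R : Type) [CommRing R] (M : ModuleCat R) : ℕ∞ :=
  sSup {n : ℕ∞ | ∃ (i : ℕ) (N : ModuleCat R), n = i ∧
    Nontrivial (((Ext R (ModuleCat R) i).obj (Opposite.op M)).obj N)}

noncomputable def edgeIdeal (K : Type) [Field K] {V : Type} (G : SimpleGraph V) :
    Ideal (MvPolynomial V K) :=
  Ideal.span {m | ∃ u v, G.Adj u v ∧ m = MvPolynomial.X u * MvPolynomial.X v}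

noncomputable def graphPd (K : Type) [Field K] {V : Type} (G : SimpleGraph V) : ℕ∞ :=
  projDim (MvPolynomial V K)
    (ModuleCat.of (MvPolynomial V K) (MvPolynomial V K ⧸ edgeIdeal K G))

/-- `A` is a dominating set: every vertex outside `A` has a neighbor in `A`. -/
def IsDominatingSet {V : Type} (G : SimpleGraph V) (A : Set V) : Prop :=
  ∀ v ∉ A, ∃ a ∈ A, G.Adj v a

/-- A set of vertices is independent if no two of its vertices are adjacent. -/
def IsIndepSet {V : Type} (G : SimpleGraph V) (A : Set V) : Prop :=
  ∀ u ∈ A, ∀ v ∈ A, ¬ G.Adj u v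

/-- `γ(G)`: the minimum size of a dominating set. -/
noncomputable def domNum {V : Type} (G : SimpleGraph V) : ℕ :=
  sInf {n | ∃ A : Set V, IsDominatingSet G A ∧ A.ncard = n}

/-- `i(G)`: the minimum size of an independent dominating set. -/
noncomputable def indDomNum {V : Type} (G : SimpleGraph V) : ℕ :=
  sInf {n | ∃ A : Set V, IsDominatingSet G A ∧ IsIndepSet G A ∧ A.ncard = n}

/-- `γ₀(X, G)`: the minimum size of a set `A` with `X ⊆ N(A)`. -/
noncomputable def gamma0Of {V : Type} (G : SimpleGraph V) (X : Set V) : ℕ :=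
  sInf {n | ∃ A : Set V, (∀ x ∈ X, ∃ a ∈ A, G.Adj x a) ∧ A.ncard = n}

/-- `γ₀(G) = γ₀(V(G), G)`. -/
noncomputable def gamma0 {V : Type} (G : SimpleGraph V) : ℕ :=
  gamma0Of G Set.univ

/-- `τ(G)`: the maximum of `γ₀(A, G)` over independent sets `A`. -/
noncomputable def tauNum {V : Type} (G : SimpleGraph V) : ℕ :=
  sSup {n | ∃ A : Set V, IsIndepSet G A ∧ gamma0Of G A = n}

/-- A set `F` of edges of `G` is edgewise dominant if every vertex of `G` is adjacent
to an endpoint of some edge in `F`. -/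
def IsEdgewiseDominant {V : Type} (G : SimpleGraph V) (F : Set (Sym2 V)) : Prop :=
  F ⊆ G.edgeSet ∧ ∀ v : V, ∃ e ∈ F, ∃ w, w ∈ e ∧ G.Adj v w

/-- `ε(G)`: the minimum size of an edgewise dominant set of edges. -/
noncomputable def epsilonNum {V : Type} (G : SimpleGraph V) : ℕ :=
  sInf {n | ∃ F : Set (Sym2 V), IsEdgewiseDominant G F ∧ F.ncard = n}

/-- A finite bound on the projective dimension bounds the degrees with nonvanishing `Ext`. -/
lemma projDim_le_of_hasProjectiveDimensionLE {R : Type} [CommRing R] (M : ModuleCat R) (p : ℕ)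
    [HasProjectiveDimensionLE M p] : projDim R M ≤ p := by
  refine sSup_le ?_
  rintro _ ⟨i, N, rfl, hN⟩
  by_contra! hlt
  have hpi : p < i := by exact_mod_cast hlt
  obtain ⟨j, rfl⟩ : ∃ j, i = j + 1 := ⟨i - 1, by omega⟩
  let P := projectiveResolution M
  refine not_subsingleton_iff_nontrivial.mpr hN (ModuleCat.subsingleton_of_isZero ?_)
  refine Limits.IsZero.of_iso ?_ (P.isoExt (R := R) (j + 1) N)
  rw [← HomologicalComplex.exactAt_iff_isZero_homology,
    HomologicalComplex.exactAt_iff' _ j (j + 1) (j + 2) (by simp) (by simp),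
    ShortComplex.moduleCat_exact_iff]
  intro (f : P.complex.X (j + 1) ⟶ N) hf
  have hf' : P.complex.d (j + 2) (j + 1) ≫ f = 0 := hf
  exact (P.extMk_eq_zero_iff f (j + 2) rfl hf' j rfl).mp
    (Abelian.Ext.eq_zero_of_hasProjectiveDimensionLT _ (p + 1) hpi)

/-- The short exact sequence `0 → R/(I : x) → R/I → R/(I, x) → 0`. -/
lemma exists_colon_shortExact {R : Type} [CommRing R] {I J : Ideal R} {x : R}
    (hJ : ∀ f, x * f ∈ I ↔ f ∈ J) :
    ∃ S : ShortComplex (ModuleCat R), S.ShortExact ∧ S.X₁ = ModuleCat.of R (R ⧸ J) ∧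
      S.X₂ = ModuleCat.of R (R ⧸ I) ∧ S.X₃ = ModuleCat.of R (R ⧸ (I ⊔ Ideal.span {x})) := by
  let f : (R ⧸ J) →ₗ[R] (R ⧸ I) :=
    Submodule.mapQ J I (LinearMap.mulLeft R x) fun a ha => (hJ a).mpr ha
  let g : (R ⧸ I) →ₗ[R] (R ⧸ (I ⊔ Ideal.span {x})) := Submodule.factor le_sup_left
  have hfg : Function.Exact f g := by
    intro b
    obtain ⟨b, rfl⟩ := Submodule.Quotient.mk_surjective _ b
    change (Submodule.Quotient.mk b : R ⧸ (I ⊔ Ideal.span {x})) = 0 ↔ _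
    rw [Submodule.Quotient.mk_eq_zero, Submodule.mem_sup]
    constructor
    · rintro ⟨y, hy, z, hz, rfl⟩
      obtain ⟨c, rfl⟩ := Ideal.mem_span_singleton'.mp hz
      refine ⟨Submodule.Quotient.mk c, ?_⟩
      change (Submodule.Quotient.mk (x * c) : R ⧸ I) = _
      rw [Submodule.Quotient.eq]
      have : x * c - (y + c * x) = -y := by ring
      rw [this]
      exact I.neg_mem hy
    · rintro ⟨c, hc⟩
      obtain ⟨c, rfl⟩ := Submodule.Quotient.mk_surjective _ c
      change (Submodule.Quotient.mk (x * c) : R ⧸ I) = _ at hc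
      rw [Submodule.Quotient.eq] at hc
      refine ⟨b - x * c, ?_, c * x, Ideal.mem_span_singleton'.mpr ⟨c, rfl⟩, by ring⟩
      rw [← neg_sub]
      exact I.neg_mem hc
  have hf : Function.Injective f := by
    rw [← LinearMap.ker_eq_bot, LinearMap.ker_eq_bot']
    intro a ha
    obtain ⟨a, rfl⟩ := Submodule.Quotient.mk_surjective _ a
    change (Submodule.Quotient.mk (x * a) : R ⧸ I) = 0 at ha
    rw [Submodule.Quotient.mk_eq_zero] at ha ⊢
    exact (hJ a).mp ha
  have hg : Function.Surjective g := Submodule.factor_surjective _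
  refine ⟨ShortComplex.mk (ModuleCat.ofHom f) (ModuleCat.ofHom g) ?_, ?_, rfl, rfl, rfl⟩
  · ext1
    exact hfg.linearMap_comp_eq_zero
  · exact ShortComplex.ShortExact.mk'
      ((ShortComplex.ShortExact.moduleCat_exact_iff_function_exact _).mpr hfg)
      ((ModuleCat.mono_iff_injective _).mpr hf) ((ModuleCat.epi_iff_surjective _).mpr hg)

/-- The edge ideal of `G` together with the variables indexed by `U`. -/
noncomputable def edgeVarIdeal (K : Type) [Field K] {V : Type} (G : SimpleGraph V)
    (U : Finset V) : Ideal (MvPolynomial V K) :=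
  edgeIdeal K G ⊔ Ideal.span (MvPolynomial.X '' (U : Set V))

section edgeVarIdeal

variable {K : Type} [Field K] {V : Type} {G : SimpleGraph V}

lemma mem_edgeVarIdeal {U : Finset V} {f : MvPolynomial V K} :
    f ∈ edgeVarIdeal K G U ↔ ∀ m ∈ f.support,
      (∃ u ∈ U, m u ≠ 0) ∨ ∃ u v, G.Adj u v ∧ m u ≠ 0 ∧ m v ≠ 0 := by
  have h : edgeVarIdeal K G U = Ideal.span ((fun s => MvPolynomial.monomial s (1 : K)) ''
      ({s | ∃ u ∈ U, s = Finsupp.single u 1} ∪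
        {s | ∃ u v, G.Adj u v ∧ s = Finsupp.single u 1 + Finsupp.single v 1})) := by
    rw [edgeVarIdeal, edgeIdeal, ← Ideal.span_union, Set.image_union, Set.union_comm]
    congr 2
    · ext p
      constructor
      · rintro ⟨u, hu, rfl⟩
        exact ⟨_, ⟨u, hu, rfl⟩, rfl⟩
      · rintro ⟨_, ⟨u, hu, rfl⟩, rfl⟩
        exact ⟨u, hu, rfl⟩
    · ext p
      constructor
      · rintro ⟨u, v, huv, rfl⟩
        exact ⟨_, ⟨u, v, huv, rfl⟩, by simp [MvPolynomial.X, MvPolynomial.monomial_mul]⟩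
      · rintro ⟨_, ⟨u, v, huv, rfl⟩, rfl⟩
        exact ⟨u, v, huv, by simp [MvPolynomial.X, MvPolynomial.monomial_mul]⟩
  rw [h, MvPolynomial.mem_ideal_span_monomial_image]
  refine forall₂_congr fun m _ => ?_
  constructor
  · rintro ⟨s, ⟨u, hu, rfl⟩ | ⟨u, v, huv, rfl⟩, hs⟩
    · refine Or.inl ⟨u, hu, ?_⟩
      have := hs u
      simp at this
      omega
    · refine Or.inr ⟨u, v, huv, ?_, ?_⟩
      · have := hs u
        simp at this
        omega
      · have := hs v
        simp at this
        omega
  · rintro (⟨u, hu, hm⟩ | ⟨u, v, huv, hmu, hmv⟩)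
    · refine ⟨_, Or.inl ⟨u, hu, rfl⟩, ?_⟩
      simpa [Nat.one_le_iff_ne_zero] using hm
    · refine ⟨_, Or.inr ⟨u, v, huv, rfl⟩, fun w => ?_⟩
      have := huv.ne
      classical
      simp only [Finsupp.add_apply, Finsupp.single_apply]
      split_ifs with h1 h2 h2 <;> subst_vars <;> first | omega | (exact absurd rfl this)

lemma edgeVarIdeal_empty : edgeVarIdeal K G ∅ = edgeIdeal K G := by
  simp [edgeVarIdeal]

variable [DecidableEq V]

lemma edgeVarIdeal_insert (U : Finset V) (x : V) :
    edgeVarIdeal K G U ⊔ Ideal.span {MvPolynomial.X x} = edgeVarIdeal K G (insert x U) := by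
  rw [edgeVarIdeal, edgeVarIdeal, Finset.coe_insert, Set.image_insert_eq, Ideal.span_insert,
    sup_assoc, sup_comm (Ideal.span {_})]

lemma X_mul_mem_edgeVarIdeal_iff [Fintype V] [DecidableRel G.Adj] {U : Finset V} {x : V}
    (hx : x ∉ U) (f : MvPolynomial V K) :
    MvPolynomial.X x * f ∈ edgeVarIdeal K G U ↔
      f ∈ edgeVarIdeal K G (U ∪ G.neighborFinset x) := by
  rw [mem_edgeVarIdeal, mem_edgeVarIdeal, MvPolynomial.support_X_mul]
  simp only [Finset.forall_mem_map, addLeftEmbedding_apply, Finsupp.add_apply]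
  refine forall₂_congr fun m _ => ?_
  have key : ∀ v, (Finsupp.single x 1 : V →₀ ℕ) v + m v ≠ 0 ↔ v = x ∨ m v ≠ 0 := by
    intro v
    by_cases h : v = x
    · simp [h]
    · simp [h]
  simp only [key, Finset.mem_union, SimpleGraph.mem_neighborFinset]
  constructor
  · rintro (⟨u, hu, rfl | hm⟩ | ⟨u, v, huv, rfl | hu, rfl | hv⟩)
    · exact absurd hu hx
    · exact Or.inl ⟨u, Or.inl hu, hm⟩
    · exact absurd rfl huv.ne
    · exact Or.inl ⟨v, Or.inr huv, hv⟩
    · exact Or.inl ⟨u, Or.inr huv.symm, hu⟩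
    · exact Or.inr ⟨u, v, huv, hu, hv⟩
  · rintro (⟨u, hu | hu, hm⟩ | ⟨u, v, huv, hu, hv⟩)
    · exact Or.inl ⟨u, hu, Or.inr hm⟩
    · exact Or.inr ⟨x, u, hu, Or.inl rfl, Or.inr hm⟩
    · exact Or.inr ⟨u, v, huv, Or.inr hu, Or.inr hv⟩

lemma exists_edgeVarIdeal_shortExact [Fintype V] [DecidableRel G.Adj] {U : Finset V} {x : V}
    (hx : x ∉ U) :
    ∃ S : ShortComplex (ModuleCat (MvPolynomial V K)), S.ShortExact ∧
      S.X₁ = ModuleCat.of _ (MvPolynomial V K ⧸ edgeVarIdeal K G (U ∪ G.neighborFinset x)) ∧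
      S.X₂ = ModuleCat.of _ (MvPolynomial V K ⧸ edgeVarIdeal K G U) ∧
      S.X₃ = ModuleCat.of _ (MvPolynomial V K ⧸ edgeVarIdeal K G (insert x U)) := by
  rw [← edgeVarIdeal_insert]
  exact exists_colon_shortExact (X_mul_mem_edgeVarIdeal_iff hx)

lemma hasProjectiveDimensionLE_edgeVarIdeal_bot [Fintype V] (U : Finset V) :
    HasProjectiveDimensionLE (ModuleCat.of (MvPolynomial V K)
      (MvPolynomial V K ⧸ edgeVarIdeal K (⊥ : SimpleGraph V) U)) U.card := by
  induction U using Finset.induction_on with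
  | empty =>
    have h : edgeVarIdeal K (⊥ : SimpleGraph V) ∅ = ⊥ := by
      simp [edgeVarIdeal, edgeIdeal]
    rw [h, Finset.card_empty, ← projective_iff_hasProjectiveDimensionLE_zero,
      ← IsProjective.iff_projective]
    exact Module.Projective.of_equiv
      (Submodule.quotEquivOfEqBot (⊥ : Ideal (MvPolynomial V K)) rfl).symm
  | insert x U hx ih =>
    obtain ⟨S, hS, h₁, h₂, h₃⟩ := exists_edgeVarIdeal_shortExact (K := K) (G := ⊥) hx
    have hN : U ∪ (⊥ : SimpleGraph V).neighborFinset x = U := by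
      ext; simp
    rw [hN] at h₁
    rw [← h₃, Finset.card_insert_of_notMem hx]
    exact hS.hasProjectiveDimensionLT_X₃ _ (h₁ ▸ ih)
      (h₂ ▸ hasProjectiveDimensionLT_of_ge _ (U.card + 1) _ (by omega))

lemma hasProjectiveDimensionLE_edgeVarIdeal_of_isVertexCover [Fintype V] {U : Finset V}
    (hU : ∀ u v, G.Adj u v → u ∈ U ∨ v ∈ U) :
    HasProjectiveDimensionLE (ModuleCat.of (MvPolynomial V K)
      (MvPolynomial V K ⧸ edgeVarIdeal K G U)) U.card := by
  have h : edgeVarIdeal K G U = edgeVarIdeal K ⊥ U := by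
    ext f
    rw [mem_edgeVarIdeal, mem_edgeVarIdeal]
    refine forall₂_congr fun m _ => ⟨?_, ?_⟩
    · rintro (h | ⟨u, v, huv, hu, hv⟩)
      · exact Or.inl h
      · rcases hU u v huv with h | h
        · exact Or.inl ⟨u, h, hu⟩
        · exact Or.inl ⟨v, h, hv⟩
    · rintro (h | ⟨u, v, huv, -⟩)
      · exact Or.inl h
      · exact huv.elim
  rw [h]
  exact hasProjectiveDimensionLE_edgeVarIdeal_bot U

variable [Fintype V] [DecidableRel G.Adj]

variable (G) in
/-- The vertices outside `U` all of whose neighbors lie in `U`. -/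
def isolatedOutside (U : Finset V) : Finset V :=
  {v | v ∉ U ∧ ∀ w, G.Adj v w → w ∈ U}

lemma mem_isolatedOutside {U : Finset V} {v : V} :
    v ∈ isolatedOutside G U ↔ v ∉ U ∧ ∀ w, G.Adj v w → w ∈ U := by
  simp [isolatedOutside]

/-- For an independent set `A` and any `U`, some set `B` dominating the vertices of `A` that are
not in `U` and not isolated outside `U` satisfies
`pd (S/J) + |isolatedOutside G U| + |B| ≤ |V|`, where `J = edgeVarIdeal K G U`. -/
lemma exists_cover_and_hasProjectiveDimensionLE (hiso : ∀ v : V, ∃ w, G.Adj v w)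
    {A : Set V} (hA : IsIndepSet G A) (U : Finset V) :
    ∃ (B : Finset V) (p : ℕ), (∀ a ∈ A, a ∉ U → a ∉ isolatedOutside G U → ∃ b ∈ B, G.Adj a b) ∧
      HasProjectiveDimensionLE (ModuleCat.of (MvPolynomial V K)
        (MvPolynomial V K ⧸ edgeVarIdeal K G U)) p ∧
      p + (isolatedOutside G U).card + B.card ≤ Fintype.card V := by
  induction hn : Uᶜ.card using Nat.strong_induction_on generalizing U with
  | _ n ih =>
  subst hn
  choose nb hnb using hiso
  by_cases hU : ∀ u v, G.Adj u v → u ∈ U ∨ v ∈ U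
  · refine ⟨∅, U.card, ?_, hasProjectiveDimensionLE_edgeVarIdeal_of_isVertexCover hU, ?_⟩
    · intro a _ haU ha
      exact absurd (mem_isolatedOutside.mpr ⟨haU, fun w hw => (hU a w hw).resolve_left haU⟩) ha
    · have hd : Disjoint U (isolatedOutside G U) :=
        Finset.disjoint_right.mpr fun v hv => (mem_isolatedOutside.mp hv).1
      rw [Finset.card_empty, add_zero, ← Finset.card_union_of_disjoint hd]
      exact Finset.card_le_univ _
  · obtain ⟨x, y, hxy, hxU, hyU, hxA⟩ : ∃ x y, G.Adj x y ∧ x ∉ U ∧ y ∉ U ∧ x ∉ A := by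
      push Not at hU
      obtain ⟨u, v, huv, hu, hv⟩ := hU
      by_cases huA : u ∈ A
      · exact ⟨v, u, huv.symm, hv, hu, fun hvA => hA u huA v hvA huv⟩
      · exact ⟨u, v, huv, hu, hv, huA⟩
    have hlt {W : Finset V} (hUW : U ⊆ W) {z : V} (hz : z ∈ W) (hzU : z ∉ U) :
        Wᶜ.card < Uᶜ.card :=
      Finset.card_lt_card (Finset.compl_ssubset_compl.mpr ⟨hUW, fun h => hzU (h hz)⟩)
    obtain ⟨B₁, p₁, hB₁, hp₁, hc₁⟩ := ih _ (hlt Finset.subset_union_left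
      (Finset.mem_union_right U ((G.mem_neighborFinset x y).mpr hxy)) hyU) _ rfl
    obtain ⟨B₃, p₃, hB₃, hp₃, hc₃⟩ := ih _ (hlt (Finset.subset_insert x U)
      (Finset.mem_insert_self x U) hxU) _ rfl
    obtain ⟨S, hS, h₁, h₂, h₃⟩ := exists_edgeVarIdeal_shortExact (K := K) (G := G) hxU
    rw [← h₁] at hp₁
    rw [← h₃] at hp₃
    rw [← h₂]
    rcases le_total p₁ p₃ with hp | hp
    · refine ⟨B₃ ∪ (isolatedOutside G (insert x U) \ isolatedOutside G U).image nb, p₃, ?_,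
        hS.hasProjectiveDimensionLT_X₂ _
          (hasProjectiveDimensionLT_of_ge _ (p₁ + 1) _ (by omega)) hp₃, ?_⟩
      · intro a ha haU hai
        by_cases hai' : a ∈ isolatedOutside G (insert x U)
        · exact ⟨nb a, Finset.mem_union_right _ (Finset.mem_image_of_mem _
            (Finset.mem_sdiff.mpr ⟨hai', hai⟩)), hnb a⟩
        · have hax : a ≠ x := fun h => hxA (h ▸ ha)
          obtain ⟨b, hb, hab⟩ := hB₃ a ha (by simp [hax, haU]) hai'
          exact ⟨b, Finset.mem_union_left _ hb, hab⟩
      · have hsub : isolatedOutside G U ⊆ isolatedOutside G (insert x U) := by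
          intro v hv
          rw [mem_isolatedOutside] at hv ⊢
          have hvx : v ≠ x := by
            rintro rfl
            exact hyU (hv.2 y hxy)
          exact ⟨by simp [hvx, hv.1], fun w hw => Finset.mem_insert_of_mem (hv.2 w hw)⟩
        have h1 := Finset.card_union_le B₃
          ((isolatedOutside G (insert x U) \ isolatedOutside G U).image nb)
        have h2 : ((isolatedOutside G (insert x U) \ isolatedOutside G U).image nb).card ≤ _ :=
          Finset.card_image_le
        have h3 := Finset.card_sdiff_add_card_eq_card hsub
        omega
    · set W := U ∪ G.neighborFinset x with hW
      refine ⟨insert x (B₁ ∪ (isolatedOutside G W \ insert x (isolatedOutside G U)).image nb), p₁,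
        ?_, hS.hasProjectiveDimensionLT_X₂ _ hp₁
          (hasProjectiveDimensionLT_of_ge _ (p₃ + 1) _ (by omega)), ?_⟩
      · intro a ha haU hai
        have hax : a ≠ x := fun h => hxA (h ▸ ha)
        by_cases haW : a ∈ W
        · have : G.Adj x a := by simpa [hW, haU] using haW
          exact ⟨x, Finset.mem_insert_self _ _, this.symm⟩
        by_cases hai' : a ∈ isolatedOutside G W
        · exact ⟨nb a, Finset.mem_insert_of_mem (Finset.mem_union_right _
            (Finset.mem_image_of_mem _ (by simp [hai', hai, hax]))), hnb a⟩
        · obtain ⟨b, hb, hab⟩ := hB₁ a ha haW hai'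
          exact ⟨b, Finset.mem_insert_of_mem (Finset.mem_union_left _ hb), hab⟩
      · have hxi : x ∉ isolatedOutside G U := fun h => hyU ((mem_isolatedOutside.mp h).2 y hxy)
        have hsub : insert x (isolatedOutside G U) ⊆ isolatedOutside G W := by
          refine Finset.insert_subset ?_ fun v hv => ?_
          · rw [mem_isolatedOutside]
            exact ⟨by simp [hW, hxU], fun w hw => by simp [hW, hw]⟩
          · rw [mem_isolatedOutside] at hv ⊢
            have hvx : ¬ G.Adj x v := fun h => hxU (hv.2 x h.symm)
            exact ⟨by simp [hW, hv.1, hvx], fun w hw => Finset.mem_union_left _ (hv.2 w hw)⟩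
        have h0 := Finset.card_insert_le x
          (B₁ ∪ (isolatedOutside G W \ insert x (isolatedOutside G U)).image nb)
        have h1 := Finset.card_union_le B₁
          ((isolatedOutside G W \ insert x (isolatedOutside G U)).image nb)
        have h2 : ((isolatedOutside G W \ insert x (isolatedOutside G U)).image nb).card ≤ _ :=
          Finset.card_image_le
        have h3 := Finset.card_sdiff_add_card_eq_card hsub
        rw [Finset.card_insert_of_notMem hxi] at h3
        omega

end edgeVarIdeal

/-- pd(G) ≤ n - τ(G), stated as pd(G) + τ(G) ≤ n. -/
theorem stmt10 (K : Type) [Field K] {V : Type} [Fintype V] (G : SimpleGraph V)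
    (hiso : ∀ v : V, ∃ w, G.Adj v w) :
    graphPd K G + (tauNum G : ℕ∞) ≤ (Fintype.card V : ℕ∞) := by
  classical
  have hpd (A : Set V) (hA : IsIndepSet G A) :
      graphPd K G + (gamma0Of G A : ℕ∞) ≤ (Fintype.card V : ℕ∞) := by
    obtain ⟨B, p, hB, hp, hc⟩ := exists_cover_and_hasProjectiveDimensionLE (K := K) hiso hA ∅
    rw [edgeVarIdeal_empty] at hp
    have hle : gamma0Of G A ≤ B.card := by
      refine Nat.sInf_le ⟨B, fun a ha => ?_, Set.ncard_coe_finset B⟩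
      refine hB a ha (Finset.notMem_empty a) fun h => ?_
      obtain ⟨w, hw⟩ := hiso a
      exact Finset.notMem_empty w ((mem_isolatedOutside.mp h).2 w hw)
    calc graphPd K G + (gamma0Of G A : ℕ∞) ≤ (p : ℕ∞) + (B.card : ℕ∞) :=
          add_le_add (projDim_le_of_hasProjectiveDimensionLE _ p) (by exact_mod_cast hle)
      _ ≤ (Fintype.card V : ℕ∞) := by exact_mod_cast (by omega : p + B.card ≤ Fintype.card V)
  have hmem : tauNum G ∈ {n | ∃ A : Set V, IsIndepSet G A ∧ gamma0Of G A = n} := by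
    refine Nat.sSup_mem ⟨_, ∅, fun _ h => h.elim, rfl⟩ ⟨Fintype.card V, ?_⟩
    rintro _ ⟨A, hA, rfl⟩
    exact_mod_cast le_add_self.trans (hpd A hA)
  obtain ⟨A, hA, hAτ⟩ := hmem
  exact hAτ ▸ hpd A hA
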